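/- arXiv:2603.12838 — 5 statements merged into one kernel-verified Lean document; each statement's English description precedes it below -/
import Mathlib

section
/- Let h : ℝ^d → ℝ be ζ_h-HRUC regular on an open convex domain (twice differentiable with positive definite Hessian), and let g(x) := ‖x‖²/2. Then the kernel φ := h + g is ζ_h-HRUC regular: for every δ ≥ 0 and all x, y in the domain of h with ρ_φ(x,y) ≤ δ, one has R_φ(x,y) ≤ ζ_h(δ). -/
open Matrix

/-- The spectral (ℓ² operator) norm of a real matrix. -/
noncomputable def specNorm {n : Type*} [Fintype n] [DecidableEq n] (M : Matrix n n ℝ) : ℝ :=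
  ‖(Matrix.toEuclideanCLM (𝕜 := ℝ) M : EuclideanSpace ℝ n →L[ℝ] EuclideanSpace ℝ n)‖

theorem aux_norm_le {E : Type*} [NormedAddCommGroup E] [InnerProductSpace ℝ E] (u v : E)
    (h : 0 ≤ inner ℝ u v) : ‖u‖ ≤ ‖u + v‖ := by
  have h1 := norm_add_sq_real u v
  apply le_of_sq_le_sq _ (norm_nonneg _)
  nlinarith [sq_nonneg ‖v‖]

theorem aux_inner_nonneg {d : ℕ} (B : Matrix (Fin d) (Fin d) ℝ) (hB : B.PosDef)
    (v : EuclideanSpace ℝ (Fin d)) :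
    0 ≤ inner ℝ (Matrix.toEuclideanCLM (𝕜 := ℝ) B v) v := by
  have h := hB.posSemidef.dotProduct_mulVec_nonneg v.ofLp
  have h2 : inner ℝ (Matrix.toEuclideanCLM (𝕜 := ℝ) B v) v = star v.ofLp ⬝ᵥ (B *ᵥ v.ofLp) := by
    rw [EuclideanSpace.inner_eq_star_dotProduct, Matrix.ofLp_toEuclideanCLM]
    simp
  rw [h2]; exact h

theorem aux_mono {d : ℕ}
    (s : Set (EuclideanSpace ℝ (Fin d)))
    (grad : EuclideanSpace ℝ (Fin d) → EuclideanSpace ℝ (Fin d))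
    (hess : EuclideanSpace ℝ (Fin d) → Matrix (Fin d) (Fin d) ℝ)
    (hconv : Convex ℝ s)
    (hhess : ∀ x ∈ s, HasFDerivAt grad (Matrix.toEuclideanCLM (𝕜 := ℝ) (hess x)) x)
    (hpos : ∀ x ∈ s, (hess x).PosDef) (x y : EuclideanSpace ℝ (Fin d)) (hx : x ∈ s) (hy : y ∈ s) :
    0 ≤ inner ℝ (grad x - grad y) (x - y) := by
  have hmem : ∀ t ∈ Set.Icc (0:ℝ) 1, y + t • (x - y) ∈ s := fun t ht =>
    hconv.add_smul_sub_mem hy hx ht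
  have hd : ∀ t ∈ Set.Icc (0:ℝ) 1,
      HasDerivAt (fun t : ℝ => inner ℝ (grad (y + t • (x - y))) (x - y))
        (inner ℝ (Matrix.toEuclideanCLM (𝕜 := ℝ) (hess (y + t • (x - y))) (x - y)) (x - y)) t := by
    intro t ht
    have h1 : HasDerivAt (fun t : ℝ => y + t • (x - y)) (x - y) t := by
      simpa using ((hasDerivAt_id t).smul_const (x - y)).const_add y
    have h2 := (hhess _ (hmem t ht)).comp_hasDerivAt t h1
    simpa using h2.inner ℝ (hasDerivAt_const t (x - y))
  have hm : MonotoneOn (fun t : ℝ => inner ℝ (grad (y + t • (x - y))) (x - y))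
      (Set.Icc (0:ℝ) 1) := by
    apply monotoneOn_of_deriv_nonneg (convex_Icc 0 1)
    · exact fun t ht => (hd t ht).continuousAt.continuousWithinAt
    · exact fun t ht => (hd t (interior_subset ht)).differentiableAt.differentiableWithinAt
    · intro t ht
      rw [(hd t (interior_subset ht)).deriv]
      exact aux_inner_nonneg _ (hpos _ (hmem t (interior_subset ht))) _
  have := hm (Set.left_mem_Icc.2 zero_le_one) (Set.right_mem_Icc.2 zero_le_one) zero_le_one
  simp only [zero_smul, add_zero, one_smul, add_sub_cancel] at this
  rw [inner_sub_left]; linarith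

theorem aux_contract {d : ℕ} (B : Matrix (Fin d) (Fin d) ℝ) (hB : B.PosDef) :
    specNorm (B * (B + 1)⁻¹) ≤ 1 := by
  have hu : IsUnit (B + 1).det := (hB.add Matrix.PosDef.one).det_pos.ne'.isUnit
  refine ContinuousLinearMap.opNorm_le_bound _ zero_le_one fun w => ?_
  set z := Matrix.toEuclideanCLM (𝕜 := ℝ) (B + 1)⁻¹ w with hz
  have h1 : Matrix.toEuclideanCLM (𝕜 := ℝ) B z + z = w := by
    have : Matrix.toEuclideanCLM (𝕜 := ℝ) ((B + 1) * (B + 1)⁻¹) w = w := by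
      rw [Matrix.mul_nonsing_inv _ hu, map_one]; rfl
    rw [map_mul, map_add, map_one] at this
    exact this
  have h2 := aux_norm_le _ _ (aux_inner_nonneg B hB z)
  rw [h1] at h2
  rw [one_mul, map_mul]
  exact h2

/-- **HRUC regularity is preserved by adding the quadratic kernel `g(x) = ‖x‖²/2`.**
If `h` is `ζ_h`-HRUC regular on an open convex domain `s`, then `φ = h + g` with
`g(x) = ‖x‖²/2` (so `∇φ = ∇h + id` and `∇²φ(x) = ∇²h(x) + I`) is `ζ_h`-HRUC regular:
for every `δ ≥ 0` and all `x, y ∈ s` with `ρ_φ(x,y) ≤ δ`, one has `R_φ(x,y) ≤ ζ_h δ`. -/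
theorem hruc_add_quadratic {d : ℕ}
    (s : Set (EuclideanSpace ℝ (Fin d)))
    (h : EuclideanSpace ℝ (Fin d) → ℝ)
    (grad : EuclideanSpace ℝ (Fin d) → EuclideanSpace ℝ (Fin d))
    (hess : EuclideanSpace ℝ (Fin d) → Matrix (Fin d) (Fin d) ℝ)
    (ζ : ℝ → ℝ)
    -- the domain is open and convex
    (hopen : IsOpen s) (hconv : Convex ℝ s)
    -- `grad` is the gradient of `h` and `hess` its (positive definite) Hessian
    (hgrad : ∀ x ∈ s, HasGradientAt h (grad x) x)
    (hhess : ∀ x ∈ s, HasFDerivAt grad (Matrix.toEuclideanCLM (𝕜 := ℝ) (hess x)) x)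
    (hpos : ∀ x ∈ s, (hess x).PosDef)
    -- `ζ` is a distortion modulus
    (hζmono : Monotone ζ) (hζcont : Continuous ζ) (hζ0 : ζ 0 = 0)
    (hζnonneg : ∀ δ : ℝ, 0 ≤ δ → 0 ≤ ζ δ)
    -- `h` is `ζ`-HRUC regular on `s`
    (hHRUC : ∀ δ : ℝ, 0 ≤ δ → ∀ x ∈ s, ∀ y ∈ s,
      ‖grad x - grad y‖ ≤ δ → specNorm (hess x * (hess y)⁻¹ - 1) ≤ ζ δ) :
    -- conclusion: `φ = h + ‖·‖²/2` is `ζ`-HRUC regular on `s`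
    ∀ δ : ℝ, 0 ≤ δ → ∀ x ∈ s, ∀ y ∈ s,
      ‖(grad x + x) - (grad y + y)‖ ≤ δ →
        specNorm ((hess x + 1) * (hess y + 1)⁻¹ - 1) ≤ ζ δ := by
  intro δ hδ x hx y hy hxy
  have hB := hpos y hy
  have h1 : ‖grad x - grad y‖ ≤ δ := by
    refine (aux_norm_le _ _ (aux_mono s grad hess hconv hhess hpos x y hx hy)).trans ?_
    rwa [add_sub_add_comm] at hxy
  have h2 := hHRUC δ hδ x hx y hy h1
  have hu : IsUnit (hess y).det := hB.det_pos.ne'.isUnit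
  have hu1 : IsUnit (hess y + 1).det := (hB.add Matrix.PosDef.one).det_pos.ne'.isUnit
  have h3 : (hess x + 1) * (hess y + 1)⁻¹ - 1
      = (hess x * (hess y)⁻¹ - 1) * (hess y * (hess y + 1)⁻¹) := by
    have e1 : (hess x * (hess y)⁻¹ - 1) * (hess y * (hess y + 1)⁻¹)
        = (hess x * ((hess y)⁻¹ * hess y) - hess y) * (hess y + 1)⁻¹ := by noncomm_ring
    rw [e1, Matrix.nonsing_inv_mul _ hu]
    have e2 := Matrix.mul_nonsing_inv _ hu1
    rw [add_mul, one_mul] at e2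
    rw [mul_one, sub_mul, add_mul, one_mul, ← sub_eq_zero, ← sub_eq_zero.2 e2]
    abel
  rw [h3]
  have h4 : specNorm ((hess x * (hess y)⁻¹ - 1) * (hess y * (hess y + 1)⁻¹))
      ≤ specNorm (hess x * (hess y)⁻¹ - 1) * specNorm (hess y * (hess y + 1)⁻¹) := by
    unfold specNorm
    rw [map_mul]
    exact norm_mul_le _ _
  refine h4.trans ?_
  calc _ ≤ specNorm (hess x * (hess y)⁻¹ - 1) * 1 :=
        mul_le_mul_of_nonneg_left (aux_contract _ hB) (norm_nonneg _)
    _ ≤ ζ δ := by rwa [mul_one]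
end

section
/- Let h : dom h ⊆ ℝ^d → ℝ be twice continuously differentiable on its open convex domain, with ∇²h(w) positive definite for all w, such that ∇h is a bijection from dom h onto an open convex set D ⊆ ℝ^d, and suppose h is ζ-HRUC regular. Let f be twice continuously differentiable and L-smooth relative to h, i.e. −L·∇²h(w) ⪯ ∇²f(w) ⪯ L·∇²h(w) for all w ∈ dom h. Fix z ∈ D and set H_z* := [∇²h(w_z)]⁻¹ where w_z is the unique point with ∇h(w_z) = z. Then for any δ ≥ 0 and any x, y ∈ dom h with ‖∇h(x) − z‖ ≤ δ and ‖∇h(y) − z‖ ≤ δ, one has ‖∇f(y) − ∇f(x)‖_{H_z*} ≤ L·(1 + ζ(δ))·‖∇h(y) − ∇h(x)‖_{H_z*}, where ‖u‖_H := √(uᵀ H u). -/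
open Matrix

/-- The local norm `‖u‖_H = √(uᵀ H u)` induced by a positive definite matrix `H`. -/
noncomputable def mnorm {d : ℕ} (H : Matrix (Fin d) (Fin d) ℝ)
    (u : EuclideanSpace ℝ (Fin d)) : ℝ :=
  Real.sqrt (u ⬝ᵥ (H *ᵥ u))


lemma aux_sym {d : ℕ} {M : Matrix (Fin d) (Fin d) ℝ} (hM : M.IsHermitian) (x y : Fin d → ℝ) :
    x ⬝ᵥ (M *ᵥ y) = y ⬝ᵥ (M *ᵥ x) := by
  have hT : Mᵀ = M := by simpa [Matrix.IsHermitian, conjTranspose_eq_transpose_of_trivial] using hM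
  rw [Matrix.dotProduct_mulVec, dotProduct_comm, ← Matrix.mulVec_transpose, hT]

lemma aux_pos {d : ℕ} {M : Matrix (Fin d) (Fin d) ℝ} (hM : M.PosSemidef) (x : Fin d → ℝ) :
    0 ≤ x ⬝ᵥ (M *ᵥ x) := by simpa using hM.dotProduct_mulVec_nonneg x

/-- Weighted arithmetic-geometric inequality for a form `F` dominated by `A`. -/
lemma aux_cs {d : ℕ} {A F : Matrix (Fin d) (Fin d) ℝ} (hF : F.IsHermitian)
    (hA : A.IsHermitian) (L : ℝ) (hL : 0 < L)
    (h1 : ∀ x : Fin d → ℝ, x ⬝ᵥ (F *ᵥ x) ≤ L * (x ⬝ᵥ (A *ᵥ x)))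
    (h2 : ∀ x : Fin d → ℝ, -(L * (x ⬝ᵥ (A *ᵥ x))) ≤ x ⬝ᵥ (F *ᵥ x))
    (q a : Fin d → ℝ) :
    q ⬝ᵥ (F *ᵥ a) ≤ (q ⬝ᵥ (A *ᵥ q) + L ^ 2 * (a ⬝ᵥ (A *ᵥ a))) / 2 := by
  have e1 := h1 (q + L • a)
  have e2 := h2 (q - L • a)
  simp only [Matrix.mulVec_add, Matrix.mulVec_sub, Matrix.mulVec_smul, dotProduct_add,
    add_dotProduct, sub_dotProduct, dotProduct_sub, smul_dotProduct, dotProduct_smul,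
    smul_eq_mul] at e1 e2
  rw [aux_sym hF a q, aux_sym hA a q] at e1 e2
  have : L * (q ⬝ᵥ (F *ᵥ a)) ≤ L * ((q ⬝ᵥ (A *ᵥ q) + L ^ 2 * (a ⬝ᵥ (A *ᵥ a))) / 2) := by
    nlinarith
  exact le_of_mul_le_mul_left this hL

lemma aux_inv {d : ℕ} {A : Matrix (Fin d) (Fin d) ℝ} (hA : A.PosDef) (u : Fin d → ℝ) :
    A *ᵥ (A⁻¹ *ᵥ u) = u := by
  rw [Matrix.mulVec_mulVec, Matrix.mul_nonsing_inv _ ((Matrix.isUnit_iff_isUnit_det _).1 hA.isUnit),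
    Matrix.one_mulVec]

lemma aux_inv_le {d : ℕ} {A B : Matrix (Fin d) (Fin d) ℝ} (hA : A.PosDef) (hB : B.PosDef)
    (c : ℝ) (hc : 0 < c) (h : ∀ x : Fin d → ℝ, x ⬝ᵥ (A *ᵥ x) ≤ c * (x ⬝ᵥ (B *ᵥ x)))
    (u : Fin d → ℝ) : u ⬝ᵥ (B⁻¹ *ᵥ u) ≤ c * (u ⬝ᵥ (A⁻¹ *ᵥ u)) := by
  set p := B⁻¹ *ᵥ u with hp
  set q := A⁻¹ *ᵥ u with hq
  have hBp : B *ᵥ p = u := aux_inv hB u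
  have hAq : A *ᵥ q = u := aux_inv hA u
  have h1 := aux_cs hA.1 hA.1 1 one_pos (fun x => by simp)
    (fun x => by have := aux_pos hA.posSemidef x; linarith) p (c • q)
  have h2 := h p
  simp only [Matrix.mulVec_smul, dotProduct_smul, smul_dotProduct, smul_eq_mul, hAq, hBp] at h1 h2
  rw [dotProduct_comm p u, dotProduct_comm q u] at h1
  rw [dotProduct_comm p u] at h2
  have : c * (u ⬝ᵥ p) ≤ c * (c * (u ⬝ᵥ q)) := by nlinarith
  exact le_of_mul_le_mul_left this hc

lemma aux_fac {d : ℕ} {B : Matrix (Fin d) (Fin d) ℝ} (hB : B.PosDef) :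
    ∃ C : Matrix (Fin d) (Fin d) ℝ, IsUnit C ∧ B = Cᵀ * C := by
  open scoped MatrixOrder in
  obtain ⟨C, hC⟩ := CStarAlgebra.nonneg_iff_eq_star_mul_self.mp hB.posSemidef.nonneg
  have hC' : B = Cᵀ * C := by
    rw [hC, star_eq_conjTranspose, conjTranspose_eq_transpose_of_trivial]
  refine ⟨C, ?_, hC'⟩
  have := (Matrix.isUnit_iff_isUnit_det _).1 hB.isUnit
  rw [hC', Matrix.det_mul] at this
  exact (Matrix.isUnit_iff_isUnit_det _).2 (isUnit_of_mul_isUnit_right this)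

lemma aux_spec {d : ℕ} {A B : Matrix (Fin d) (Fin d) ℝ} (hA : A.PosDef) (hB : B.PosDef)
    (ε : ℝ) (h : specNorm (A * B⁻¹ - 1) ≤ ε) (x : Fin d → ℝ) :
    x ⬝ᵥ (A *ᵥ x) ≤ (1 + ε) * (x ⬝ᵥ (B *ᵥ x)) := by
  obtain ⟨C, hCu, hBC⟩ := aux_fac hB
  have hCd := (Matrix.isUnit_iff_isUnit_det _).1 hCu
  have hCTd : IsUnit (Cᵀ).det := by rwa [Matrix.det_transpose]
  set S := (C⁻¹)ᵀ * A * C⁻¹ with hS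
  have hAT : Aᵀ = A := by
    simpa [Matrix.IsHermitian, conjTranspose_eq_transpose_of_trivial] using hA.1
  have hherm : ((1 + ε) • (1 : Matrix (Fin d) (Fin d) ℝ) - S).IsHermitian := by
    simp [Matrix.IsHermitian, conjTranspose_eq_transpose_of_trivial, hS, hAT, Matrix.mul_assoc]
  have hAS : A = Cᵀ * S * C := by
    rw [hS, Matrix.transpose_nonsing_inv]
    simp only [← Matrix.mul_assoc]
    rw [Matrix.mul_nonsing_inv _ hCTd, Matrix.one_mul, Matrix.mul_assoc,
      Matrix.nonsing_inv_mul _ hCd, Matrix.mul_one]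
  have hpsd : ((1 + ε) • (1 : Matrix (Fin d) (Fin d) ℝ) - S).PosSemidef := by
    rw [hherm.posSemidef_iff_eigenvalues_nonneg]
    intro i
    have hv := hherm.mulVec_eigenvectorBasis i
    set v := hherm.eigenvectorBasis i with hvdef
    set l := hherm.eigenvalues i
    have hSv : S *ᵥ v.ofLp = (1 + ε - l) • v.ofLp := by
      rw [Matrix.sub_mulVec, Matrix.smul_mulVec, Matrix.one_mulVec] at hv
      rw [sub_smul, ← hv]; abel
    let y : EuclideanSpace ℝ (Fin d) := WithLp.toLp 2 (Cᵀ *ᵥ v.ofLp)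
    have hMy : (Matrix.toEuclideanCLM (𝕜 := ℝ) (A * B⁻¹ - 1)) y = (ε - l) • y := by
      have : A * B⁻¹ * Cᵀ = Cᵀ * S := by
        rw [hBC, Matrix.mul_inv_rev, hAS]
        simp only [Matrix.mul_assoc]
        rw [Matrix.nonsing_inv_mul _ hCTd, Matrix.mul_one, Matrix.mul_nonsing_inv _ hCd,
          Matrix.mul_one]
      simp only [y]
      rw [Matrix.toEuclideanCLM_toLp, Matrix.sub_mulVec, Matrix.mulVec_mulVec, this,
        Matrix.one_mulVec, ← Matrix.mulVec_mulVec, hSv, Matrix.mulVec_smul, ← WithLp.toLp_smul]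
      congr 1
      rw [sub_smul, add_smul, sub_smul, one_smul]; abel
    have hy : 0 < ‖y‖ := by
      rw [norm_pos_iff]
      intro h0
      have h1 : Cᵀ *ᵥ v.ofLp = 0 := by simpa [y] using h0
      have h2 : v.ofLp = 0 := by
        have := congrArg (fun w => (Cᵀ)⁻¹ *ᵥ w) h1
        simpa [Matrix.mulVec_mulVec, Matrix.nonsing_inv_mul _ hCTd] using this
      have h3 : ‖v‖ = 1 := hherm.eigenvectorBasis.orthonormal.1 i
      have h4 : v = 0 := by ext j; simp [h2]
      simp [h4] at h3
    have hle := (Matrix.toEuclideanCLM (𝕜 := ℝ) (A * B⁻¹ - 1)).le_opNorm y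
    rw [hMy, norm_smul] at hle
    have h5 : |ε - l| ≤ ε := (le_of_mul_le_mul_right hle hy).trans h
    have h5' := (abs_le.1 h5).2
    show 0 ≤ l
    linarith
  have h6 := aux_pos hpsd (C *ᵥ x)
  rw [Matrix.sub_mulVec, Matrix.smul_mulVec, Matrix.one_mulVec, dotProduct_sub, dotProduct_smul,
    smul_eq_mul] at h6
  have h7 : x ⬝ᵥ (A *ᵥ x) = (C *ᵥ x) ⬝ᵥ (S *ᵥ (C *ᵥ x)) := by
    rw [hAS, ← Matrix.mulVec_mulVec, ← Matrix.mulVec_mulVec, Matrix.dotProduct_mulVec x,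
      Matrix.vecMul_transpose]
  have h8 : x ⬝ᵥ (B *ᵥ x) = (C *ᵥ x) ⬝ᵥ (C *ᵥ x) := by
    rw [hBC, ← Matrix.mulVec_mulVec, Matrix.dotProduct_mulVec x, Matrix.vecMul_transpose]
  rw [h7, h8]; linarith

lemma aux_main {d : ℕ} {A B F : Matrix (Fin d) (Fin d) ℝ} (hA : A.PosDef) (hB : B.PosDef)
    (ε L : ℝ) (hε : 0 ≤ ε) (hL : 0 < L) (h1 : specNorm (A * B⁻¹ - 1) ≤ ε)
    (h2 : specNorm (B * A⁻¹ - 1) ≤ ε) (h3 : (L • A - F).PosSemidef)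
    (h4 : (F + L • A).PosSemidef) (v : Fin d → ℝ) :
    (F *ᵥ (A⁻¹ *ᵥ v)) ⬝ᵥ (B⁻¹ *ᵥ (F *ᵥ (A⁻¹ *ᵥ v))) ≤
      (L * (1 + ε)) ^ 2 * (v ⬝ᵥ (B⁻¹ *ᵥ v)) := by
  have hc : 0 < 1 + ε := by linarith
  have hF : F.IsHermitian := by
    have := h4.1.sub (hA.1.smul (show IsSelfAdjoint L from rfl))
    simpa using this
  set a := A⁻¹ *ᵥ v with ha
  set u := F *ᵥ a with hu
  have hAa : A *ᵥ a = v := aux_inv hA v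
  have i1 := aux_inv_le hA hB _ hc (aux_spec hA hB ε h1) u
  have i2 := aux_inv_le hB hA _ hc (aux_spec hB hA ε h2) v
  have i3 := aux_cs hF hA.1 L hL
    (fun x => by
      have := aux_pos h3 x
      rw [Matrix.sub_mulVec, Matrix.smul_mulVec, dotProduct_sub, dotProduct_smul,
        smul_eq_mul] at this
      linarith)
    (fun x => by
      have := aux_pos h4 x
      rw [Matrix.add_mulVec, Matrix.smul_mulVec, dotProduct_add, dotProduct_smul,
        smul_eq_mul] at this
      linarith) (A⁻¹ *ᵥ u) a
  rw [aux_inv hA, hAa, ← hu, dotProduct_comm _ u, dotProduct_comm a v] at i3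
  have i4 : u ⬝ᵥ (A⁻¹ *ᵥ u) ≤ L ^ 2 * (v ⬝ᵥ a) := by linarith
  calc u ⬝ᵥ (B⁻¹ *ᵥ u) ≤ (1 + ε) * (u ⬝ᵥ (A⁻¹ *ᵥ u)) := i1
    _ ≤ (1 + ε) * (L ^ 2 * ((1 + ε) * (v ⬝ᵥ (B⁻¹ *ᵥ v)))) := by
        gcongr
        exact i4.trans (by gcongr)
    _ = _ := by ring

/-- **Lipschitz continuity in the distortion geometry.**
Let `h` be twice continuously differentiable on its open convex domain `s` with positive
definite Hessian, such that `∇h` is a bijection from `s` onto an open convex set `D`, and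
suppose `h` is `ζ`-HRUC regular. Let `f` be twice continuously differentiable and `L`-smooth
relative to `h` (i.e. `−L∇²h ⪯ ∇²f ⪯ L∇²h` on `s`). Fix `z ∈ D` and let `wz ∈ s` with
`∇h(wz) = z`, and set `Hz* = [∇²h(wz)]⁻¹`. Then for any `δ ≥ 0` and `x, y ∈ s` with
`‖∇h(x) − z‖ ≤ δ` and `‖∇h(y) − z‖ ≤ δ`,
`‖∇f(y) − ∇f(x)‖_{Hz*} ≤ L(1 + ζ(δ))·‖∇h(y) − ∇h(x)‖_{Hz*}`. -/
theorem lipschitz_in_distortion_geometry {d : ℕ}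
    (s D : Set (EuclideanSpace ℝ (Fin d)))
    (h f : EuclideanSpace ℝ (Fin d) → ℝ)
    (gradh gradf : EuclideanSpace ℝ (Fin d) → EuclideanSpace ℝ (Fin d))
    (hessh hessf : EuclideanSpace ℝ (Fin d) → Matrix (Fin d) (Fin d) ℝ)
    (ζ : ℝ → ℝ) (L : ℝ) (hL : 0 < L)
    -- the domain of `h` is open and convex
    (hsopen : IsOpen s) (hsconv : Convex ℝ s)
    -- `h` is twice continuously differentiable with positive definite Hessian
    (hgrad : ∀ w ∈ s, HasGradientAt h (gradh w) w)
    (hhess : ∀ w ∈ s, HasFDerivAt gradh (Matrix.toEuclideanCLM (𝕜 := ℝ) (hessh w)) w)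
    (hhesscont : ContinuousOn hessh s)
    (hpos : ∀ w ∈ s, (hessh w).PosDef)
    -- `∇h` maps `s` bijectively onto the open convex set `D`
    (hDopen : IsOpen D) (hDconv : Convex ℝ D)
    (hbij : Set.BijOn gradh s D)
    -- `ζ` is a distortion modulus and `h` is `ζ`-HRUC regular on `s`
    (hζmono : Monotone ζ) (hζcont : Continuous ζ) (hζ0 : ζ 0 = 0)
    (hζnonneg : ∀ δ : ℝ, 0 ≤ δ → 0 ≤ ζ δ)
    (hHRUC : ∀ δ : ℝ, 0 ≤ δ → ∀ x ∈ s, ∀ y ∈ s,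
      ‖gradh x - gradh y‖ ≤ δ → specNorm (hessh x * (hessh y)⁻¹ - 1) ≤ ζ δ)
    -- `f` is twice continuously differentiable
    (fgrad : ∀ w ∈ s, HasGradientAt f (gradf w) w)
    (fhess : ∀ w ∈ s, HasFDerivAt gradf (Matrix.toEuclideanCLM (𝕜 := ℝ) (hessf w)) w)
    (fhesscont : ContinuousOn hessf s)
    -- `f` is `L`-smooth relative to `h`: `−L∇²h(w) ⪯ ∇²f(w) ⪯ L∇²h(w)` for all `w ∈ s`
    (hrel₁ : ∀ w ∈ s, (L • hessh w - hessf w).PosSemidef)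
    (hrel₂ : ∀ w ∈ s, (hessf w + L • hessh w).PosSemidef)
    -- the covector `z` and the base point `wz` with `∇h(wz) = z`
    (z : EuclideanSpace ℝ (Fin d)) (hz : z ∈ D)
    (wz : EuclideanSpace ℝ (Fin d)) (hwz : wz ∈ s) (hwzz : gradh wz = z) :
    ∀ δ : ℝ, 0 ≤ δ → ∀ x ∈ s, ∀ y ∈ s,
      ‖gradh x - z‖ ≤ δ → ‖gradh y - z‖ ≤ δ →
        mnorm (hessh wz)⁻¹ (gradf y - gradf x) ≤
          L * (1 + ζ δ) * mnorm (hessh wz)⁻¹ (gradh y - gradh x) := by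
  intro δ hδ x hx y hy hxδ hyδ
  set B := hessh wz with hBdef
  have hB : B.PosDef := hpos wz hwz
  set g := Function.invFunOn gradh s with hg
  have hleft : ∀ w ∈ s, g (gradh w) = w := fun w hw => hbij.injOn.leftInvOn_invFunOn hw
  have hright : ∀ p ∈ D, g p ∈ s ∧ gradh (g p) = p := fun p hp =>
    ⟨Function.invFunOn_mem (hbij.surjOn hp), Function.invFunOn_eq (hbij.surjOn hp)⟩
  -- derivative of the inverse map
  have hcont : Continuous (fun M : Matrix (Fin d) (Fin d) ℝ =>
      (Matrix.toEuclideanCLM (𝕜 := ℝ) M : EuclideanSpace ℝ (Fin d) →L[ℝ] EuclideanSpace ℝ (Fin d))) :=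
    LinearMap.continuous_of_finiteDimensional
      ((Matrix.toEuclideanCLM (n := Fin d) (𝕜 := ℝ)).toAlgEquiv.toLinearMap)
  have hginv : ∀ w ∈ s, HasFDerivAt g (Matrix.toEuclideanCLM (𝕜 := ℝ) (hessh w)⁻¹) (gradh w) := by
    intro w hw
    have hdet := (Matrix.isUnit_iff_isUnit_det _).1 (hpos w hw).isUnit
    have hstrict : HasStrictFDerivAt gradh (Matrix.toEuclideanCLM (𝕜 := ℝ) (hessh w)) w :=
      hasStrictFDerivAt_of_hasFDerivAt_of_continuousAt
        (f' := fun w => Matrix.toEuclideanCLM (𝕜 := ℝ) (hessh w))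
        (Filter.eventually_of_mem (hsopen.mem_nhds hw) hhess)
        (hcont.continuousAt.comp (hhesscont.continuousAt (hsopen.mem_nhds hw)))
    let e : EuclideanSpace ℝ (Fin d) ≃L[ℝ] EuclideanSpace ℝ (Fin d) :=
      ContinuousLinearEquiv.equivOfInverse (Matrix.toEuclideanCLM (𝕜 := ℝ) (hessh w))
        (Matrix.toEuclideanCLM (𝕜 := ℝ) (hessh w)⁻¹)
        (fun v => by
          rw [← ContinuousLinearMap.mul_apply, ← map_mul, Matrix.nonsing_inv_mul _ hdet, map_one]
          rfl)
        (fun v => by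
          rw [← ContinuousLinearMap.mul_apply, ← map_mul, Matrix.mul_nonsing_inv _ hdet, map_one]
          rfl)
    have hstrict' : HasStrictFDerivAt gradh (e : EuclideanSpace ℝ (Fin d) →L[ℝ] _) w := hstrict
    exact (hstrict'.to_local_left_inverse
      (Filter.eventually_of_mem (hsopen.mem_nhds hw) hleft)).hasFDerivAt
  set v := gradh y - gradh x with hv
  set E := gradf y - gradf x with hE
  -- the dual segment
  let p : ℝ → EuclideanSpace ℝ (Fin d) := fun t => gradh x + t • v
  have hpD : ∀ t ∈ Set.Icc (0 : ℝ) 1, p t ∈ D := fun t ht =>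
    hDconv.add_smul_sub_mem (hbij.mapsTo hx) (hbij.mapsTo hy) ht
  have hpz : ∀ t ∈ Set.Icc (0 : ℝ) 1, ‖p t - z‖ ≤ δ := by
    intro t ht
    have := (convex_closedBall z δ).add_smul_sub_mem (x := gradh x) (y := gradh y)
      (by simpa [dist_eq_norm] using hxδ) (by simpa [dist_eq_norm] using hyδ) ht
    simpa [dist_eq_norm] using this
  let ℓ : EuclideanSpace ℝ (Fin d) →L[ℝ] ℝ := innerSL ℝ (WithLp.toLp 2 (B⁻¹ *ᵥ E.ofLp))
  have hℓ : ∀ u : EuclideanSpace ℝ (Fin d), ℓ u = u.ofLp ⬝ᵥ (B⁻¹ *ᵥ E.ofLp) := by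
    intro u
    simp [ℓ, EuclideanSpace.inner_eq_star_dotProduct]
  let φ : ℝ → ℝ := fun t => ℓ (gradf (g (p t)))
  let A : ℝ → Matrix (Fin d) (Fin d) ℝ := fun t => hessh (g (p t))
  let F : ℝ → Matrix (Fin d) (Fin d) ℝ := fun t => hessf (g (p t))
  let φ' : ℝ → ℝ := fun t => ℓ (WithLp.toLp 2 (F t *ᵥ ((A t)⁻¹ *ᵥ v.ofLp)))
  have hφ : ∀ t ∈ Set.Icc (0 : ℝ) 1, HasDerivAt φ (φ' t) t := by
    intro t ht
    obtain ⟨hgs, hgp⟩ := hright _ (hpD t ht)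
    have hp' : HasDerivAt p v t := by
      have h0 := ((hasDerivAt_id t).smul_const v).const_add (gradh x)
      rw [one_smul] at h0
      exact h0
    have h1 := hginv _ hgs
    rw [hgp] at h1
    have h2 := h1.comp_hasDerivAt t hp'
    have h3 := (fhess _ hgs).comp_hasDerivAt t h2
    have h4 := ℓ.hasFDerivAt.comp_hasDerivAt t h3
    exact h4
  obtain ⟨t, ht, hslope⟩ := exists_hasDerivAt_eq_slope φ φ' one_pos
    (fun t ht => (hφ t ht).continuousAt.continuousWithinAt)
    (fun t ht => hφ t (Set.Ioo_subset_Icc_self ht))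
  have ht' := Set.Ioo_subset_Icc_self ht
  obtain ⟨hgs, hgp⟩ := hright _ (hpD t ht')
  have hgz : ‖gradh (g (p t)) - gradh wz‖ ≤ δ := by rw [hgp, hwzz]; exact hpz t ht'
  have hmain := aux_main (hpos _ hgs) hB (ζ δ) L (hζnonneg δ hδ) hL
    (hHRUC δ hδ _ hgs _ hwz hgz)
    (hHRUC δ hδ _ hwz _ hgs (by rwa [norm_sub_rev])) (hrel₁ _ hgs) (hrel₂ _ hgs) v.ofLp
  have hp0 : g (p 0) = x := by simp only [p, zero_smul, add_zero]; exact hleft x hx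
  have hp1 : g (p 1) = y := by
    simp only [p, one_smul, hv, add_sub_cancel]; exact hleft y hy
  have hEE : φ 1 - φ 0 = E.ofLp ⬝ᵥ (B⁻¹ *ᵥ E.ofLp) := by
    simp only [φ]
    rw [hp0, hp1, ← map_sub, hℓ]
  have hcs := aux_cs hB.inv.1 hB.inv.1 1 one_pos (fun x => by simp)
    (fun x => by have := aux_pos hB.inv.posSemidef x; linarith)
    (F t *ᵥ ((A t)⁻¹ *ᵥ v.ofLp)) E.ofLp
  simp only [φ', hℓ, sub_zero, div_one] at hslope
  rw [hslope, hEE] at hcs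
  have hfin : E.ofLp ⬝ᵥ (B⁻¹ *ᵥ E.ofLp) ≤ (L * (1 + ζ δ)) ^ 2 * (v.ofLp ⬝ᵥ (B⁻¹ *ᵥ v.ofLp)) := by
    refine le_trans ?_ hmain
    linarith
  have hK : 0 ≤ L * (1 + ζ δ) := by have := hζnonneg δ hδ; positivity
  unfold mnorm
  refine (Real.sqrt_le_sqrt hfin).trans ?_
  rw [Real.sqrt_mul (sq_nonneg _), Real.sqrt_sq hK]
end

section
/- Let μ > 0, r > 0, and consider the power kernel h : ℝ^d → ℝ, h(x) := (μ/2)‖x‖² + ‖x‖^{r+2}/(r+2). Then for every δ ≥ 0 and all x, y ∈ ℝ^d with ‖∇h(x) − ∇h(y)‖ ≤ δ, one has ‖∇²h(x)[∇²h(y)]⁻¹ − I‖ ≤ (max{10, r²·2^{r+1}}/μ)·(δ/μ^{1/r} + δ^r/μ^r). In particular, h is HRUC regular with distortion modulus ζ(δ) = (max{10, r²·2^{r+1}}/μ)·(δ/μ^{1/r} + δ^r/μ^r). -/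
open Matrix Real

/-- The power kernel `h(x) = (μ/2)‖x‖² + ‖x‖^{r+2}/(r+2)`. -/
noncomputable def powerKernel {d : ℕ} (μ r : ℝ) (x : EuclideanSpace ℝ (Fin d)) : ℝ :=
  μ / 2 * ‖x‖ ^ 2 + ‖x‖ ^ (r + 2) / (r + 2)

/-- The gradient `∇h(x) = (μ + ‖x‖^r)·x` of the power kernel. -/
noncomputable def powerGrad {d : ℕ} (μ r : ℝ) (x : EuclideanSpace ℝ (Fin d)) :
    EuclideanSpace ℝ (Fin d) :=
  (μ + ‖x‖ ^ r) • x

/-- The Hessian `∇²h(x) = (μ + ‖x‖^r)·I + r‖x‖^{r−2}·xxᵀ` of the power kernel. -/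
noncomputable def powerHess {d : ℕ} (μ r : ℝ) (x : EuclideanSpace ℝ (Fin d)) :
    Matrix (Fin d) (Fin d) ℝ :=
  (μ + ‖x‖ ^ r) • (1 : Matrix (Fin d) (Fin d) ℝ) +
    (r * ‖x‖ ^ (r - 2)) • Matrix.vecMulVec x x


lemma hk_apply {d : ℕ} (μ r : ℝ) (hr : 0 < r) (x v : EuclideanSpace ℝ (Fin d)) :
    (Matrix.toEuclideanCLM (𝕜 := ℝ) (powerHess μ r x)) v =
      (μ + ‖x‖ ^ r) • v + (r * ‖x‖ ^ r * inner ℝ (‖x‖⁻¹ • x) v) • (‖x‖⁻¹ • x) := by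
  have h1 : (Matrix.toEuclideanCLM (𝕜 := ℝ) (powerHess μ r x)) v =
      (μ + ‖x‖ ^ r) • v + (r * ‖x‖ ^ (r - 2) * inner ℝ x v) • x := by
    ext i
    simp [powerHess, Matrix.ofLp_toEuclideanCLM, Matrix.add_mulVec, Matrix.smul_mulVec,
      Matrix.vecMulVec_mulVec, EuclideanSpace.inner_eq_star_dotProduct, dotProduct_comm]
    try ring
  rw [h1]
  congr 1
  rcases eq_or_ne x 0 with rfl | hx
  · simp
  · have hp : 0 < ‖x‖ := norm_pos_iff.2 hx
    rw [smul_smul, real_inner_smul_left, Real.rpow_sub hp, Real.rpow_two]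
    congr 1
    field_simp

lemma hk_unit {x : ℝ} (hx : 0 ≤ x) : x⁻¹ * x ≤ 1 := by
  rcases hx.eq_or_lt with rfl | h
  · simp
  · rw [inv_mul_cancel₀ h.ne']

lemma hk_norm_e {d : ℕ} (x : EuclideanSpace ℝ (Fin d)) : ‖(‖x‖⁻¹ • x)‖ ≤ 1 := by
  rw [norm_smul, norm_inv, norm_norm]; exact hk_unit (norm_nonneg x)

lemma hk_coer {d : ℕ} (μ r : ℝ) (hμ : 0 < μ) (hr : 0 < r) (x v : EuclideanSpace ℝ (Fin d)) :
    (μ + ‖x‖ ^ r) * ‖v‖ ≤ ‖(Matrix.toEuclideanCLM (𝕜 := ℝ) (powerHess μ r x)) v‖ := by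
  rcases eq_or_ne v 0 with rfl | hv
  · simp
  have hp : 0 < ‖v‖ := norm_pos_iff.2 hv
  have h1 := real_inner_le_norm ((Matrix.toEuclideanCLM (𝕜 := ℝ) (powerHess μ r x)) v) v
  rw [hk_apply μ r hr, inner_add_left, real_inner_smul_left, real_inner_smul_left,
    real_inner_self_eq_norm_sq, ← hk_apply μ r hr] at h1
  have h2 : 0 ≤ r * ‖x‖ ^ r * inner ℝ (‖x‖⁻¹ • x) v * inner ℝ (‖x‖⁻¹ • x) v := by
    rw [mul_assoc]
    exact mul_nonneg (by positivity) (mul_self_nonneg _)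
  refine le_of_mul_le_mul_right ?_ hp
  nlinarith

lemma hk_mono {d : ℕ} (μ r : ℝ) (hμ : 0 < μ) (hr : 0 < r) (x y : EuclideanSpace ℝ (Fin d)) :
    μ * ‖x - y‖ ≤ ‖powerGrad μ r x - powerGrad μ r y‖ := by
  rcases eq_or_ne (x - y) 0 with h | hv
  · rw [h]; simp
  have hp : 0 < ‖x - y‖ := norm_pos_iff.2 hv
  have h1 := real_inner_le_norm (powerGrad μ r x - powerGrad μ r y) (x - y)
  have h2 : inner ℝ (powerGrad μ r x - powerGrad μ r y) (x - y) =
      μ * ‖x - y‖ ^ 2 + (‖x‖ ^ r * ‖x‖ ^ 2 + ‖y‖ ^ r * ‖y‖ ^ 2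
        - (‖x‖ ^ r + ‖y‖ ^ r) * inner ℝ x y) := by
    rw [norm_sub_sq_real]
    simp only [powerGrad, inner_sub_left, inner_sub_right, real_inner_smul_left,
      real_inner_self_eq_norm_sq, real_inner_comm x y]
    ring
  have h3 := real_inner_le_norm x y
  have hA : 0 ≤ ‖x‖ ^ r := by positivity
  have hB : 0 ≤ ‖y‖ ^ r := by positivity
  have h4 : 0 ≤ (‖x‖ ^ r * ‖x‖ - ‖y‖ ^ r * ‖y‖) * (‖x‖ - ‖y‖) := by
    rcases le_total ‖x‖ ‖y‖ with h | h
    · have := Real.rpow_le_rpow (norm_nonneg _) h hr.le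
      have := mul_le_mul this h (norm_nonneg _) hB
      exact mul_nonneg_of_nonpos_of_nonpos (by linarith) (by linarith)
    · have := Real.rpow_le_rpow (norm_nonneg _) h hr.le
      have := mul_le_mul this h (norm_nonneg _) hA
      exact mul_nonneg (by linarith) (by linarith)
  refine le_of_mul_le_mul_right ?_ hp
  nlinarith [mul_le_mul_of_nonneg_left h3 (add_nonneg hA hB)]

lemma hk_ang {d : ℕ} (x y : EuclideanSpace ℝ (Fin d)) (h : ‖y‖ ≤ ‖x‖) :
    ‖y‖ * ‖(‖x‖⁻¹ • x) - (‖y‖⁻¹ • y)‖ ≤ ‖x - y‖ := by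
  rcases eq_or_ne y 0 with rfl | hy
  · simp
  have hp : 0 < ‖y‖ := norm_pos_iff.2 hy
  have hq : 0 < ‖x‖ := lt_of_lt_of_le hp h
  refine le_of_sq_le_sq ?_ (norm_nonneg _)
  rw [mul_pow, norm_sub_sq_real, norm_sub_sq_real, norm_smul, norm_smul, real_inner_smul_left,
    real_inner_smul_right, norm_inv, norm_inv, norm_norm, norm_norm, inv_mul_cancel₀ hp.ne',
    inv_mul_cancel₀ hq.ne']
  have h3 := real_inner_le_norm x y
  set s : ℝ := inner ℝ x y
  obtain ⟨c, hc⟩ : ∃ c, s = c * (‖x‖ * ‖y‖) := ⟨s / (‖x‖ * ‖y‖), by field_simp⟩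
  have hc1 : c ≤ 1 := by
    rw [hc] at h3
    exact le_of_mul_le_mul_right (by linarith) (mul_pos hq hp)
  rw [hc]
  have : ‖x‖⁻¹ * (‖y‖⁻¹ * (c * (‖x‖ * ‖y‖))) = c := by field_simp
  rw [this]
  nlinarith [mul_nonneg (mul_nonneg hp.le (sub_nonneg.2 h)) (sub_nonneg.2 hc1),
    mul_nonneg (sub_nonneg.2 h) (sub_nonneg.2 h)]

lemma hk_diff {d : ℕ} (μ r : ℝ) (hr : 0 < r) (x y v : EuclideanSpace ℝ (Fin d))
    (h : ‖y‖ ≤ ‖x‖) (K : ℝ) (hK : K = 1 ∨ K = ‖(‖x‖⁻¹ • x) - (‖y‖⁻¹ • y)‖) :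
    ‖(Matrix.toEuclideanCLM (𝕜 := ℝ) (powerHess μ r x)) v -
      (Matrix.toEuclideanCLM (𝕜 := ℝ) (powerHess μ r y)) v‖ ≤
      ((1 + r) * (‖x‖ ^ r - ‖y‖ ^ r) + 2 * r * ‖y‖ ^ r * K) * ‖v‖ := by
  rw [hk_apply μ r hr, hk_apply μ r hr]
  have he := hk_norm_e x
  have hf := hk_norm_e y
  have hA := Real.rpow_le_rpow (norm_nonneg _) h hr.le
  have hB : 0 ≤ ‖y‖ ^ r := by positivity
  set e := ‖x‖⁻¹ • x
  set f := ‖y‖⁻¹ • y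
  set A := ‖x‖ ^ r
  set B := ‖y‖ ^ r
  have key : ∀ p q : EuclideanSpace ℝ (Fin d), ‖p‖ ≤ 1 →
      ‖(inner ℝ q v) • p‖ ≤ ‖q‖ * ‖v‖ ∧ ‖(inner ℝ p v) • q‖ ≤ ‖q‖ * ‖v‖ := by
    intro p q hp
    constructor
    · rw [norm_smul]
      have := norm_inner_le_norm (𝕜 := ℝ) q v
      calc _ ≤ (‖q‖ * ‖v‖) * 1 := mul_le_mul this hp (norm_nonneg _) (by positivity)
        _ = _ := mul_one _
    · rw [norm_smul]
      have h1 := norm_inner_le_norm (𝕜 := ℝ) p v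
      have h2 : ‖p‖ * ‖v‖ ≤ ‖v‖ := mul_le_of_le_one_left (norm_nonneg _) hp
      rw [mul_comm]
      exact mul_le_mul_of_nonneg_left (h1.trans h2) (norm_nonneg _)
  have kk : ∀ p : EuclideanSpace ℝ (Fin d), ‖p‖ ≤ 1 → ‖(inner ℝ p v) • p‖ ≤ ‖v‖ := by
    intro p hp
    exact (key p p hp).1.trans (mul_le_of_le_one_left (norm_nonneg _) hp)
  have hd : ‖(inner ℝ e v) • e - (inner ℝ f v) • f‖ ≤ 2 * K * ‖v‖ := by
    rcases hK with rfl | rfl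
    · refine (norm_sub_le _ _).trans ?_
      linarith [kk e he, kk f hf]
    · have : (inner ℝ e v) • e - (inner ℝ f v) • f =
          (inner ℝ e v) • (e - f) + (inner ℝ (e - f) v) • f := by
        rw [inner_sub_left]; module
      rw [this]
      refine (norm_add_le _ _).trans ?_
      linarith [(key e (e - f) he).2, (key f (e - f) hf).1]
  have hdec : (μ + A) • v + (r * A * inner ℝ e v) • e - ((μ + B) • v + (r * B * inner ℝ f v) • f)
      = (A - B) • v + (r * (A - B)) • ((inner ℝ e v) • e) +
        (r * B) • ((inner ℝ e v) • e - (inner ℝ f v) • f) := by module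
  rw [hdec]
  have hAB : 0 ≤ A - B := sub_nonneg.2 hA
  refine (norm_add₃_le).trans ?_
  rw [norm_smul, norm_smul (r * (A - B)), norm_smul (r * B), Real.norm_of_nonneg hAB,
    Real.norm_of_nonneg (mul_nonneg hr.le hAB), Real.norm_of_nonneg (mul_nonneg hr.le hB)]
  nlinarith [mul_le_mul_of_nonneg_left (kk e he) (mul_nonneg hr.le hAB),
    mul_le_mul_of_nonneg_left hd (mul_nonneg hr.le hB)]

/-- small exponents -/
lemma hk_small {d : ℕ} (μ r : ℝ) (hr : 0 < r) (hr1 : r ≤ 1) (x y v : EuclideanSpace ℝ (Fin d))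
    (h : ‖y‖ ≤ ‖x‖) :
    ‖(Matrix.toEuclideanCLM (𝕜 := ℝ) (powerHess μ r x)) v -
      (Matrix.toEuclideanCLM (𝕜 := ℝ) (powerHess μ r y)) v‖ ≤
      (4 * ‖x - y‖ ^ r) * ‖v‖ := by
  have h1 : ‖x‖ ^ r - ‖y‖ ^ r ≤ ‖x - y‖ ^ r := by
    have h2 : ‖x‖ ^ r ≤ (‖x - y‖ + ‖y‖) ^ r :=
      Real.rpow_le_rpow (norm_nonneg _) (by linarith [norm_sub_norm_le x y]) hr.le
    have h3 := Real.rpow_add_le_add_rpow (norm_nonneg (x - y)) (norm_nonneg y) hr.le hr1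
    linarith
  have hang := hk_ang x y h
  have hT : 0 ≤ ‖x - y‖ ^ r := by positivity
  set k := ‖(‖x‖⁻¹ • x) - (‖y‖⁻¹ • y)‖ with hk
  have hk0 : 0 ≤ k := norm_nonneg _
  obtain ⟨K, hK, hKk⟩ : ∃ K, (K = 1 ∨ K = k) ∧ K ≤ k ^ r := by
    rcases le_total k 1 with hk1 | hk1
    · refine ⟨k, Or.inr rfl, ?_⟩
      rcases hk0.eq_or_lt with h0 | h0
      · rw [← h0]; positivity
      · simpa using Real.rpow_le_rpow_of_exponent_ge h0 hk1 hr1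
    · exact ⟨1, Or.inl rfl, Real.one_le_rpow hk1 hr.le⟩
  refine (hk_diff μ r hr x y v h K hK).trans ?_
  gcongr
  have h5 : ‖y‖ ^ r * K ≤ ‖x - y‖ ^ r := by
    calc _ ≤ ‖y‖ ^ r * k ^ r := by gcongr
      _ = (‖y‖ * k) ^ r := (Real.mul_rpow (norm_nonneg _) hk0).symm
      _ ≤ _ := Real.rpow_le_rpow (by positivity) hang hr.le
  nlinarith [mul_le_mul_of_nonneg_left h1 (by linarith : 0 ≤ 1 + r),
    mul_le_mul_of_nonneg_left h5 hr.le, mul_le_mul_of_nonneg_right hr1 hT]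

lemma hk_bern {a b r : ℝ} (hr : 1 ≤ r) (hb : 0 ≤ b) (hab : b ≤ a) :
    a ^ r - b ^ r ≤ r * a ^ (r - 1) * (a - b) := by
  rcases (hb.trans hab).eq_or_lt with h0 | ha
  · have : b = a := by linarith
    subst this; simp
  have h1 := one_add_mul_self_le_rpow_one_add (s := b / a - 1) (by
    have : 0 ≤ b / a := by positivity
    linarith) hr
  have h2 : 1 + (b / a - 1) = b / a := by ring
  rw [h2, Real.div_rpow hb ha.le] at h1
  have h3 : 0 < a ^ r := by positivity
  rw [le_div_iff₀ h3] at h1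
  rw [Real.rpow_sub ha, Real.rpow_one]
  have : (1 + r * (b / a - 1)) * a ^ r = a ^ r - r * (a ^ r / a) * (a - b) := by
    field_simp; ring
  linarith

lemma hk_large {d : ℕ} (μ r : ℝ) (hr1 : 1 ≤ r) (x y v : EuclideanSpace ℝ (Fin d))
    (h : ‖y‖ ≤ ‖x‖) :
    ‖(Matrix.toEuclideanCLM (𝕜 := ℝ) (powerHess μ r x)) v -
      (Matrix.toEuclideanCLM (𝕜 := ℝ) (powerHess μ r y)) v‖ ≤
      (r * (r + 3) * ‖x‖ ^ (r - 1) * ‖x - y‖) * ‖v‖ := by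
  have hr : 0 < r := by linarith
  refine (hk_diff μ r hr x y v h _ (Or.inr rfl)).trans ?_
  have hang := hk_ang x y h
  set k := ‖(‖x‖⁻¹ • x) - (‖y‖⁻¹ • y)‖ with hk
  have hk0 : 0 ≤ k := norm_nonneg _
  gcongr
  have hP : 0 ≤ ‖x‖ ^ (r - 1) := by positivity
  have h1 : ‖x‖ ^ r - ‖y‖ ^ r ≤ r * ‖x‖ ^ (r - 1) * ‖x - y‖ :=
    (hk_bern hr1 (norm_nonneg y) h).trans (by gcongr; exact norm_sub_norm_le x y)
  have h2 : ‖y‖ ^ r * k ≤ ‖x‖ ^ (r - 1) * ‖x - y‖ := by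
    rcases (norm_nonneg y).eq_or_lt with h0 | h0
    · rw [← h0, Real.zero_rpow hr.ne', zero_mul]; positivity
    · have : ‖y‖ ^ r = ‖y‖ ^ (r - 1) * ‖y‖ := by
        rw [Real.rpow_sub h0, Real.rpow_one]; field_simp
      rw [this, mul_assoc]
      have := Real.rpow_le_rpow h0.le h (by linarith : 0 ≤ r - 1)
      gcongr
  nlinarith [mul_le_mul_of_nonneg_left h1 (by linarith : 0 ≤ 1 + r),
    mul_le_mul_of_nonneg_left h2 hr.le]

lemma hk_young {s μ r : ℝ} (hμ : 0 < μ) (hr : 1 ≤ r) (hs : 0 ≤ s) :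
    s ^ (r - 1) * μ ^ (1 / r) ≤ μ + s ^ r := by
  have hr0 : 0 < r := by linarith
  set m := μ ^ (1 / r) with hm
  have hm0 : 0 < m := by positivity
  have e : μ = m ^ r := by
    rw [hm, ← Real.rpow_mul hμ.le, one_div_mul_cancel hr0.ne', Real.rpow_one]
  have aux : ∀ M : ℝ, 0 < M → M ^ (r - 1) * M = M ^ r := by
    intro M hM
    rw [Real.rpow_sub hM, Real.rpow_one]; field_simp
  rw [e]
  have hS : 0 ≤ s ^ r := by positivity
  have hM : 0 ≤ m ^ r := by positivity
  rcases le_total s m with h | h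
  · have := Real.rpow_le_rpow hs h (by linarith : 0 ≤ r - 1)
    have := mul_le_mul_of_nonneg_right this hm0.le
    rw [aux m hm0] at this
    linarith
  · have hs0 : 0 < s := by linarith
    have := mul_le_mul_of_nonneg_left h (by positivity : 0 ≤ s ^ (r - 1))
    rw [aux s hs0] at this
    linarith

lemma hk_bound {d : ℕ} (μ r : ℝ) (hμ : 0 < μ) (hr : 0 < r) (x y v : EuclideanSpace ℝ (Fin d)) :
    ‖(Matrix.toEuclideanCLM (𝕜 := ℝ) (powerHess μ r x)) v -
      (Matrix.toEuclideanCLM (𝕜 := ℝ) (powerHess μ r y)) v‖ ≤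
      (max 10 (r ^ 2 * 2 ^ (r + 1)) * (‖x - y‖ / μ ^ (1 / r) + ‖x - y‖ ^ r / μ)) *
        ((μ + ‖y‖ ^ r) * ‖v‖) := by
  set C := max 10 (r ^ 2 * 2 ^ (r + 1)) with hC
  have hC10 : 10 ≤ C := le_max_left _ _
  have hm0 : 0 < μ ^ (1 / r) := by positivity
  have hY : 0 ≤ ‖y‖ ^ r := by positivity
  have hT : 0 ≤ ‖x - y‖ ^ r := by positivity
  have hq : ‖x - y‖ ^ r ≤ ‖x - y‖ ^ r / μ * (μ + ‖y‖ ^ r) := by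
    rw [div_mul_eq_mul_div, le_div_iff₀ hμ]
    nlinarith [mul_nonneg hT hY]
  rw [← mul_assoc]
  rcases le_total r 1 with hr1 | hr1
  · have h1 : ‖(Matrix.toEuclideanCLM (𝕜 := ℝ) (powerHess μ r x)) v -
      (Matrix.toEuclideanCLM (𝕜 := ℝ) (powerHess μ r y)) v‖ ≤ (4 * ‖x - y‖ ^ r) * ‖v‖ := by
      rcases le_total ‖y‖ ‖x‖ with h | h
      · exact hk_small μ r hr hr1 x y v h
      · rw [norm_sub_rev, norm_sub_rev x y]; exact hk_small μ r hr hr1 y x v h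
    refine h1.trans (mul_le_mul_of_nonneg_right ?_ (norm_nonneg v))
    have h2 : 0 ≤ ‖x - y‖ / μ ^ (1 / r) * (μ + ‖y‖ ^ r) := by positivity
    calc 4 * ‖x - y‖ ^ r ≤ C * ‖x - y‖ ^ r := by gcongr; linarith
      _ ≤ C * ((‖x - y‖ / μ ^ (1 / r) + ‖x - y‖ ^ r / μ) * (μ + ‖y‖ ^ r)) := by
        gcongr
        linarith
      _ = _ := by ring
  · have hr1' : 0 ≤ r - 1 := by linarith
    have h1 : ∃ M : ℝ, 0 ≤ M ∧ M ≤ ‖y‖ + ‖x - y‖ ∧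
        ‖(Matrix.toEuclideanCLM (𝕜 := ℝ) (powerHess μ r x)) v -
      (Matrix.toEuclideanCLM (𝕜 := ℝ) (powerHess μ r y)) v‖ ≤
        (r * (r + 3) * M ^ (r - 1) * ‖x - y‖) * ‖v‖ := by
      rcases le_total ‖y‖ ‖x‖ with h | h
      · exact ⟨‖x‖, norm_nonneg _, by linarith [norm_sub_norm_le x y], hk_large μ r hr1 x y v h⟩
      · refine ⟨‖y‖, norm_nonneg _, by linarith [norm_nonneg (x - y)], ?_⟩
        rw [norm_sub_rev, norm_sub_rev x y]; exact hk_large μ r hr1 y x v h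
    obtain ⟨M, hM0, hM, h1⟩ := h1
    refine h1.trans (mul_le_mul_of_nonneg_right ?_ (norm_nonneg v))
    set t := ‖x - y‖
    set s := ‖y‖
    have ht : 0 ≤ t := norm_nonneg _
    have hs : 0 ≤ s := norm_nonneg _
    have hMb : M ^ (r - 1) ≤ 2 ^ (r - 1) * (s ^ (r - 1) + t ^ (r - 1)) := by
      have a1 : 0 ≤ s ^ (r - 1) := by positivity
      have a2 : 0 ≤ t ^ (r - 1) := by positivity
      have a3 : (0 : ℝ) ≤ 2 ^ (r - 1) := by positivity
      rcases le_total s t with h | h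
      · have := Real.rpow_le_rpow hM0 (by linarith : M ≤ 2 * t) hr1'
        rw [Real.mul_rpow (by norm_num) ht] at this
        nlinarith
      · have := Real.rpow_le_rpow hM0 (by linarith : M ≤ 2 * s) hr1'
        rw [Real.mul_rpow (by norm_num) hs] at this
        nlinarith
    have hc : r * (r + 3) * 2 ^ (r - 1) ≤ C := by
      refine le_trans ?_ (le_max_right _ _)
      have : (2 : ℝ) ^ (r + 1) = 2 ^ (r - 1) * 4 := by
        rw [show r + 1 = (r - 1) + 2 by ring, Real.rpow_add (by norm_num)]; norm_num
      rw [this]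
      have a3 : (0 : ℝ) ≤ 2 ^ (r - 1) := by positivity
      nlinarith [mul_nonneg (mul_nonneg hr.le a3) hr1']
    have hy := hk_young hμ hr1 hs
    have hy' : s ^ (r - 1) * t ≤ t / μ ^ (1 / r) * (μ + s ^ r) := by
      rw [div_mul_eq_mul_div, le_div_iff₀ hm0]
      nlinarith
    have htt : t ^ (r - 1) * t ≤ t ^ r := by
      rcases ht.eq_or_lt with h0 | h0
      · rw [← h0]; simp; positivity
      · rw [Real.rpow_sub h0, Real.rpow_one]; exact le_of_eq (by field_simp)
    calc r * (r + 3) * M ^ (r - 1) * t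
        ≤ r * (r + 3) * (2 ^ (r - 1) * (s ^ (r - 1) + t ^ (r - 1))) * t := by gcongr
      _ = (r * (r + 3) * 2 ^ (r - 1)) * (s ^ (r - 1) * t + t ^ (r - 1) * t) := by ring
      _ ≤ C * (t / μ ^ (1 / r) * (μ + s ^ r) + t ^ r / μ * (μ + s ^ r)) := by
        exact mul_le_mul hc (add_le_add hy' (htt.trans hq)) (by positivity) (by linarith)
      _ = _ := by ring

/-- **HRUC regularity of power kernels.**
For `μ, r > 0` and the power kernel `h(x) = (μ/2)‖x‖² + ‖x‖^{r+2}/(r+2)`, whenever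
`‖∇h(x) − ∇h(y)‖ ≤ δ` one has
`‖∇²h(x)[∇²h(y)]⁻¹ − I‖ ≤ (max{10, r²·2^{r+1}}/μ)·(δ/μ^{1/r} + δ^r/μ^r)`,
so `h` is HRUC regular with this distortion modulus. -/
theorem hruc_power_kernel {d : ℕ} (μ r : ℝ) (hμ : 0 < μ) (hr : 0 < r) :
    ∀ δ : ℝ, 0 ≤ δ → ∀ x y : EuclideanSpace ℝ (Fin d),
      ‖powerGrad μ r x - powerGrad μ r y‖ ≤ δ →
        specNorm (powerHess μ r x * (powerHess μ r y)⁻¹ - 1) ≤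
          max 10 (r ^ 2 * 2 ^ (r + 1)) / μ * (δ / μ ^ (1 / r) + δ ^ r / μ ^ r) := by
  intro δ hδ x y hxy
  have hD : 0 < μ + ‖y‖ ^ r := by positivity
  have hm0 : 0 < μ ^ (1 / r) := by positivity
  have ht : ‖x - y‖ ≤ δ / μ := by
    rw [le_div_iff₀ hμ, mul_comm]
    exact (hk_mono μ r hμ hr x y).trans hxy
  have hu : IsUnit (powerHess μ r y) := by
    rw [← Matrix.mulVec_injective_iff_isUnit]
    have hz : ∀ w, powerHess μ r y *ᵥ w = 0 → w = 0 := by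
      intro w hw
      have h1 := hk_coer μ r hμ hr y (WithLp.toLp 2 w)
      have h2 : (Matrix.toEuclideanCLM (𝕜 := ℝ) (powerHess μ r y)) (WithLp.toLp 2 w) = 0 := by
        rw [Matrix.toEuclideanCLM_toLp, hw]; rfl
      rw [h2, norm_zero] at h1
      have h3 : ‖WithLp.toLp 2 w‖ = 0 :=
        le_antisymm (nonpos_of_mul_nonpos_right h1 hD) (norm_nonneg _)
      simpa using h3
    intro a b hab
    have := hz (a - b) (by rw [Matrix.mulVec_sub]; exact sub_eq_zero.2 hab)
    exact sub_eq_zero.1 this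
  have hdet : IsUnit (powerHess μ r y).det := (Matrix.isUnit_iff_isUnit_det _).1 hu
  have hfin : max 10 (r ^ 2 * 2 ^ (r + 1)) * (‖x - y‖ / μ ^ (1 / r) + ‖x - y‖ ^ r / μ) ≤
      max 10 (r ^ 2 * 2 ^ (r + 1)) / μ * (δ / μ ^ (1 / r) + δ ^ r / μ ^ r) := by
    have h1 : ‖x - y‖ ^ r ≤ δ ^ r / μ ^ r := by
      rw [← Real.div_rpow hδ hμ.le]
      exact Real.rpow_le_rpow (norm_nonneg _) ht hr.le
    calc _ ≤ max 10 (r ^ 2 * 2 ^ (r + 1)) * ((δ / μ) / μ ^ (1 / r) + (δ ^ r / μ ^ r) / μ) := by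
          gcongr
      _ = _ := by field_simp
  refine le_trans ?_ hfin
  unfold specNorm
  refine ContinuousLinearMap.opNorm_le_bound _ (by positivity) ?_
  intro v
  set w := (Matrix.toEuclideanCLM (𝕜 := ℝ) (powerHess μ r y)⁻¹) v with hw
  have hv : (Matrix.toEuclideanCLM (𝕜 := ℝ) (powerHess μ r y)) w = v := by
    rw [hw, ← ContinuousLinearMap.mul_apply, ← map_mul, Matrix.mul_nonsing_inv _ hdet, map_one]
    rfl
  have he : (Matrix.toEuclideanCLM (𝕜 := ℝ) (powerHess μ r x * (powerHess μ r y)⁻¹ - 1)) v =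
      (Matrix.toEuclideanCLM (𝕜 := ℝ) (powerHess μ r x)) w -
      (Matrix.toEuclideanCLM (𝕜 := ℝ) (powerHess μ r y)) w := by
    rw [hv, map_sub, map_mul, map_one]
    rfl
  rw [he]
  refine (hk_bound μ r hμ hr x y w).trans ?_
  have := hk_coer μ r hμ hr y w
  rw [hv] at this
  gcongr
end

section
/- Let h be the norm exponential kernel on ℝ^d, h(x) := exp(‖x‖²/2). Then for every δ ≥ 0 and all x, y ∈ ℝ^d with ‖∇h(x) − ∇h(y)‖ ≤ δ, one has ‖∇²h(x)[∇²h(y)]⁻¹ − I‖ ≤ exp(2δ) − 1; i.e., h is HRUC regular with distortion modulus ζ(δ) = exp(2δ) − 1. -/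
open Matrix Real

/-- The norm exponential kernel `h(x) = exp(‖x‖²/2)` on `ℝ^d`. -/
noncomputable def normExpKernel {d : ℕ} (x : EuclideanSpace ℝ (Fin d)) : ℝ :=
  Real.exp (‖x‖ ^ 2 / 2)

/-- The gradient of the norm exponential kernel: `∇h(x) = exp(‖x‖²/2)·x`. -/
noncomputable def normExpGrad {d : ℕ} (x : EuclideanSpace ℝ (Fin d)) :
    EuclideanSpace ℝ (Fin d) :=
  Real.exp (‖x‖ ^ 2 / 2) • x

/-- The Hessian of the norm exponential kernel: `∇²h(x) = exp(‖x‖²/2)·(I + xxᵀ)`. -/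
noncomputable def normExpHess {d : ℕ} (x : EuclideanSpace ℝ (Fin d)) :
    Matrix (Fin d) (Fin d) ℝ :=
  Real.exp (‖x‖ ^ 2 / 2) • ((1 : Matrix (Fin d) (Fin d) ℝ) + Matrix.vecMulVec x x)

section HrucAux
variable {E : Type*} [NormedAddCommGroup E] [InnerProductSpace ℝ E]

noncomputable def gE (x : E) : E := Real.exp (‖x‖ ^ 2 / 2) • x

noncomputable def hE (x q : E) : E := Real.exp (‖x‖ ^ 2 / 2) • (q + inner ℝ x q • x)

noncomputable def tE (x v q : E) : E :=
  Real.exp (‖x‖ ^ 2 / 2) • (inner ℝ x v • (q + inner ℝ x q • x) + inner ℝ v q • x + inner ℝ x q • v)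

lemma one_le_e (x : E) : 1 ≤ Real.exp (‖x‖ ^ 2 / 2) := Real.one_le_exp (by positivity)

lemma norm_le_e (x : E) : ‖x‖ ≤ Real.exp (‖x‖ ^ 2 / 2) := by
  have := Real.add_one_le_exp (‖x‖ ^ 2 / 2)
  nlinarith [sq_nonneg (‖x‖ - 1)]

lemma e_norm_le (x v : E) : Real.exp (‖x‖ ^ 2 / 2) * ‖v‖ ≤ ‖hE x v‖ := by
  rw [hE, norm_smul, Real.norm_of_nonneg (Real.exp_pos _).le]
  gcongr
  have h : ‖v‖ ^ 2 ≤ ‖v + inner ℝ x v • x‖ ^ 2 := by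
    rw [norm_add_sq_real, inner_smul_right, real_inner_comm x v]
    nlinarith [sq_nonneg (inner ℝ v x), sq_nonneg ‖inner ℝ v x • x‖]
  exact le_of_sq_le_sq h (norm_nonneg _)

lemma e_inner_le (x v : E) : 2 * (Real.exp (‖x‖ ^ 2 / 2) * |inner ℝ x v|) ≤ ‖hE x v‖ := by
  have h := abs_real_inner_le_norm x (hE x v)
  have h2 : inner ℝ x (hE x v) = (1 + ‖x‖ ^ 2) * (Real.exp (‖x‖ ^ 2 / 2) * inner ℝ x v) := by
    simp only [hE, inner_smul_right, inner_add_right, real_inner_self_eq_norm_sq]; ring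
  rw [h2, abs_mul, abs_mul, abs_of_pos (Real.exp_pos _), abs_of_pos (by positivity)] at h
  set A := Real.exp (‖x‖ ^ 2 / 2) * |inner ℝ x v| with hA
  have hA0 : 0 ≤ A := by positivity
  have hx := norm_nonneg x
  rcases hx.eq_or_lt with h0 | h0
  · have : x = 0 := norm_eq_zero.1 h0.symm
    have : A = 0 := by simp [hA, this]
    rw [this]; simp
  · refine le_of_mul_le_mul_left ?_ h0
    nlinarith [mul_nonneg hA0 (sq_nonneg (‖x‖ - 1))]

lemma tE_bound (x v q : E) : ‖tE x v q‖ ≤ 2 * ‖hE x v‖ * ‖hE x q‖ := by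
  set e := Real.exp (‖x‖ ^ 2 / 2) with he
  have he1 : 1 ≤ e := one_le_e x
  have hre : ‖x‖ ≤ e := norm_le_e x
  have a1 := e_norm_le x v
  have a2 := e_norm_le x q
  have b1 := e_inner_le x v
  have b2 := e_inner_le x q
  have hcs := abs_real_inner_le_norm v q
  have hx := norm_nonneg x
  have hv := norm_nonneg v
  have hq := norm_nonneg q
  rw [← he] at a1 a2 b1 b2
  have e1 : tE x v q = inner ℝ x v • hE x q + (e * inner ℝ v q) • x + (e * inner ℝ x q) • v := by
    simp only [tE, hE, ← he]; module
  have n1 : ‖inner ℝ x v • hE x q‖ ≤ (1/2) * (‖hE x v‖ * ‖hE x q‖) := by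
    rw [norm_smul, Real.norm_eq_abs, ← mul_assoc]
    gcongr
    nlinarith [abs_nonneg (inner ℝ x v)]
  have n2 : ‖(e * inner ℝ v q) • x‖ ≤ ‖hE x v‖ * ‖hE x q‖ := by
    rw [norm_smul, Real.norm_eq_abs, abs_mul, abs_of_pos (by linarith : (0:ℝ) < e)]
    calc e * |inner ℝ v q| * ‖x‖ ≤ e * (‖v‖ * ‖q‖) * e := by gcongr
      _ = (e * ‖v‖) * (e * ‖q‖) := by ring
      _ ≤ _ := by gcongr
  have n3 : ‖(e * inner ℝ x q) • v‖ ≤ (1/2) * (‖hE x v‖ * ‖hE x q‖) := by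
    rw [norm_smul, Real.norm_eq_abs, abs_mul, abs_of_pos (by linarith : (0:ℝ) < e)]
    have : ‖v‖ ≤ ‖hE x v‖ := by nlinarith
    calc e * |inner ℝ x q| * ‖v‖ ≤ (1/2 * ‖hE x q‖) * ‖hE x v‖ := by
          have : e * |inner ℝ x q| ≤ 1/2 * ‖hE x q‖ := by linarith
          gcongr
      _ = _ := by ring
  rw [e1]
  have := norm_add₃_le (a := inner ℝ x v • hE x q) (b := (e * inner ℝ v q) • x)
    (c := (e * inner ℝ x q) • v)
  linarith

lemma gE_mono (x y : E) : ‖x - y‖ ≤ ‖gE x - gE y‖ := by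
  have h1 : ‖x - y‖ ^ 2 ≤ inner ℝ (gE x - gE y) (x - y) := by
    have key : inner ℝ (gE x - gE y) (x - y) =
        (Real.exp (‖x‖ ^ 2 / 2) + Real.exp (‖y‖ ^ 2 / 2)) / 2 * ‖x - y‖ ^ 2 +
        (Real.exp (‖x‖ ^ 2 / 2) - Real.exp (‖y‖ ^ 2 / 2)) / 2 * (‖x‖ ^ 2 - ‖y‖ ^ 2) := by
      rw [norm_sub_sq_real]
      simp only [gE, inner_sub_left, inner_sub_right, real_inner_smul_left,
        real_inner_self_eq_norm_sq, real_inner_comm x y]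
      ring
    rw [key]
    have h3 : 0 ≤ (Real.exp (‖x‖ ^ 2 / 2) - Real.exp (‖y‖ ^ 2 / 2)) / 2 * (‖x‖ ^ 2 - ‖y‖ ^ 2) := by
      rcases le_total (‖x‖ ^ 2) (‖y‖ ^ 2) with h | h
      · have : Real.exp (‖x‖ ^ 2 / 2) ≤ Real.exp (‖y‖ ^ 2 / 2) := by gcongr
        nlinarith
      · have : Real.exp (‖y‖ ^ 2 / 2) ≤ Real.exp (‖x‖ ^ 2 / 2) := by gcongr
        apply mul_nonneg <;> linarith
    nlinarith [one_le_e x, one_le_e y, sq_nonneg ‖x - y‖]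
  have h2 := real_inner_le_norm (gE x - gE y) (x - y)
  rcases (norm_nonneg (x - y)).eq_or_lt with h0 | h0
  · rw [← h0]; positivity
  · refine le_of_mul_le_mul_right ?_ h0
    nlinarith

lemma gE_surj : Function.Surjective (gE : E → E) := by
  intro p
  by_cases hp : p = 0
  · exact ⟨0, by simp [gE, hp]⟩
  have hp0 : 0 < ‖p‖ := norm_pos_iff.2 hp
  have hc : ContinuousOn (fun t : ℝ => Real.exp (t ^ 2 / 2) * t) (Set.Icc 0 ‖p‖) := by fun_prop
  obtain ⟨t, ht, hte⟩ := intermediate_value_Icc hp0.le hc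
    (show ‖p‖ ∈ _ from ⟨by simp, by
      have := one_le_e p
      show ‖p‖ ≤ Real.exp (‖p‖ ^ 2 / 2) * ‖p‖
      nlinarith⟩)
  refine ⟨(t / ‖p‖) • p, ?_⟩
  have hn : ‖(t / ‖p‖) • p‖ = t := by
    rw [norm_smul, Real.norm_of_nonneg (div_nonneg ht.1 hp0.le)]; field_simp
  rw [gE, hn, smul_smul]
  have : Real.exp (t ^ 2 / 2) * (t / ‖p‖) = 1 := by
    rw [← mul_div_assoc]; simp only at hte; rw [hte]; field_simp
  rw [this, one_smul]

noncomputable def hL (x : E) : E →L[ℝ] E :=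
  Real.exp (‖x‖ ^ 2 / 2) • (ContinuousLinearMap.id ℝ E + (innerSL ℝ x).smulRight x)

lemma hL_apply (x q : E) : hL x q = hE x q := by
  simp [hL, hE]

lemma exp_hasFDerivAt (x : E) : HasFDerivAt (fun x : E => Real.exp (‖x‖ ^ 2 / 2))
    (Real.exp (‖x‖ ^ 2 / 2) • innerSL ℝ x) x := by
  have h := (((hasStrictFDerivAt_norm_sq x).hasFDerivAt.mul_const (1/2 : ℝ))).exp
  convert h using 1
  · ext; simp [div_eq_mul_inv]
  · ext; simp [div_eq_mul_inv]

lemma gE_hasFDerivAt (x : E) : HasFDerivAt gE (hL x) x := by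
  have h := (exp_hasFDerivAt x).smul (hasFDerivAt_id x)
  have e : hL x = Real.exp (‖x‖ ^ 2 / 2) • ContinuousLinearMap.id ℝ E +
      (Real.exp (‖x‖ ^ 2 / 2) • innerSL ℝ x).smulRight (id x) := by
    ext v; simp [hL, smul_smul]
  rw [e]; exact h

lemma hE_hasDerivAt {c : ℝ → E} {v : E} {s : ℝ} (hc : HasDerivAt c v s) (q : E) :
    HasDerivAt (fun s => hE (c s) q) (tE (c s) v q) s := by
  have h1 := (exp_hasFDerivAt (c s)).comp_hasDerivAt s hc
  have h2 : HasDerivAt (fun s => inner ℝ (c s) q) (inner ℝ v q) s := by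
    simpa using hc.inner ℝ (hasDerivAt_const s q)
  have h3 := h1.smul ((hasDerivAt_const s q).add (h2.smul hc))
  refine HasDerivAt.congr_deriv (f := fun s => hE (c s) q) h3 ?_
  simp [tE]
  module

variable [FiniteDimensional ℝ E]

lemma hL_inj (x : E) : Function.Injective (hL x) := by
  rw [injective_iff_map_eq_zero]
  intro v hv
  have := e_norm_le x v
  rw [← hL_apply, hv, norm_zero] at this
  have h1 := one_le_e x
  have := norm_nonneg v
  exact norm_eq_zero.1 (by nlinarith)

lemma path_exists (x y : E) : ∃ c c' : ℝ → E, c 0 = y ∧ c 1 = x ∧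
    ∀ s, HasDerivAt c (c' s) s ∧ hE (c s) (c' s) = gE x - gE y := by
  choose G hG using gE_surj (E := E)
  have hinj : Function.Injective (gE : E → E) := by
    intro a b hab
    have := gE_mono a b
    rw [hab, sub_self, norm_zero] at this
    exact sub_eq_zero.1 (norm_le_zero_iff.1 this)
  have hlip : LipschitzWith 1 G := by
    apply LipschitzWith.of_dist_le_mul
    intro a b
    have := gE_mono (G a) (G b)
    rw [hG, hG] at this
    simpa [dist_eq_norm] using this
  let L (z : E) : E ≃L[ℝ] E :=
    (LinearEquiv.ofInjectiveEndo (hL z : E →ₗ[ℝ] E) (hL_inj z)).toContinuousLinearEquiv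
  have hLL (z : E) : (L z : E →L[ℝ] E) = hL z := by ext v; rfl
  have hD (p : E) : HasFDerivAt G ((L (G p)).symm : E →L[ℝ] E) p := by
    apply HasFDerivAt.of_local_left_inverse (f := gE) hlip.continuous.continuousAt
    · rw [hLL]; exact gE_hasFDerivAt _
    · exact Filter.Eventually.of_forall hG
  refine ⟨fun s => G (gE y + s • (gE x - gE y)),
    fun s => (L (G (gE y + s • (gE x - gE y)))).symm (gE x - gE y), ?_, ?_, ?_⟩
  · apply hinj; simp [hG]
  · apply hinj; simp [hG]
  · intro s
    constructor
    · have h1 : HasDerivAt (fun s : ℝ => gE y + s • (gE x - gE y)) (gE x - gE y) s := by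
        simpa using ((hasDerivAt_id s).smul_const (gE x - gE y)).const_add (gE y)
      exact (hD _).comp_hasDerivAt s h1
    · rw [← hL_apply, ← hLL]; simp

lemma main_E (δ : ℝ) (x y q : E) (h : ‖gE x - gE y‖ ≤ δ) :
    ‖hE x q - hE y q‖ ≤ (Real.exp (2 * δ) - 1) * ‖hE y q‖ := by
  obtain ⟨c, c', h0, h1, hc⟩ := path_exists x y
  have hd (s : ℝ) : HasDerivAt (fun s => hE (c s) q - hE y q) (tE (c s) (c' s) q) s :=
    (hE_hasDerivAt (hc s).1 q).sub_const _
  have hδ : 0 ≤ δ := (norm_nonneg _).trans h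
  have := norm_le_gronwallBound_of_norm_deriv_right_le (a := 0) (b := 1) (δ := 0)
    (K := 2 * δ) (ε := 2 * δ * ‖hE y q‖) (f := fun s => hE (c s) q - hE y q)
    (fun s _ => (hd s).continuousAt.continuousWithinAt)
    (fun s _ => (hd s).hasDerivWithinAt) (by simp [h0])
    (fun s _ => by
      have hb := tE_bound (c s) (c' s) q
      rw [(hc s).2] at hb
      have ht : ‖hE (c s) q‖ ≤ ‖hE (c s) q - hE y q‖ + ‖hE y q‖ := norm_le_norm_sub_add _ _
      calc _ ≤ _ := hb
        _ ≤ 2 * δ * (‖hE (c s) q - hE y q‖ + ‖hE y q‖) := by gcongr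
        _ = _ := by ring) 1 (by simp)
  rw [h1] at this
  refine this.trans (le_of_eq ?_)
  rcases hδ.eq_or_lt with h | h
  · subst h; simp [gronwallBound_K0]
  · rw [gronwallBound_of_K_ne_0 (by positivity)]
    simp only [sub_zero, mul_one, zero_mul, zero_add]
    field_simp

end HrucAux

lemma hess_clm {d : ℕ} (x q : EuclideanSpace ℝ (Fin d)) :
    Matrix.toEuclideanCLM (𝕜 := ℝ) (normExpHess x) q = hE x q := by
  ext i
  simp [normExpHess, hE, Matrix.add_mulVec, Matrix.smul_mulVec, Matrix.vecMulVec_mulVec,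
    PiLp.inner_apply, dotProduct, mul_comm]

lemma hess_unit {d : ℕ} (x : EuclideanSpace ℝ (Fin d)) : IsUnit (normExpHess x) := by
  rw [← Matrix.mulVec_injective_iff_isUnit]
  intro a b hab
  have : hL x (WithLp.toLp 2 a) = hL x (WithLp.toLp 2 b) := by
    rw [hL_apply, hL_apply, ← hess_clm, ← hess_clm]
    simpa using hab
  simpa using hL_inj x this


/-- **HRUC regularity of the norm exponential kernel.**
For `h(x) = exp(‖x‖²/2)` on `ℝ^d`, whenever `‖∇h(x) − ∇h(y)‖ ≤ δ` one has
`‖∇²h(x)[∇²h(y)]⁻¹ − I‖ ≤ exp(2δ) − 1`; i.e. `h` is HRUC regular with distortion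
modulus `ζ(δ) = exp(2δ) − 1`. -/
theorem hruc_norm_exponential {d : ℕ} :
    ∀ δ : ℝ, 0 ≤ δ → ∀ x y : EuclideanSpace ℝ (Fin d),
      ‖normExpGrad x - normExpGrad y‖ ≤ δ →
        specNorm (normExpHess x * (normExpHess y)⁻¹ - 1) ≤ Real.exp (2 * δ) - 1 := by
  intro δ hδ x y h
  unfold specNorm
  refine ContinuousLinearMap.opNorm_le_bound _ (by linarith [Real.one_le_exp (by linarith : 0 ≤ 2 * δ)]) ?_
  intro z
  set q := Matrix.toEuclideanCLM (𝕜 := ℝ) (normExpHess y)⁻¹ z with hq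
  have hz : hE y q = z := by
    rw [← hess_clm, hq, ← mul_apply_eq_comp, ← map_mul,
      Matrix.mul_nonsing_inv _ ((Matrix.isUnit_iff_isUnit_det _).1 (hess_unit y))]
    simp
  have := main_E δ x y q h
  rw [hz] at this
  rw [map_sub, map_mul, map_one, _root_.sub_apply, mul_apply_eq_comp,
    ← hq, hess_clm]
  exact this
end

section
/- Let μ, ρ > 0 and let h : ℝ^d → ℝ be three times continuously differentiable, μ-strongly convex (∇²h(x) ⪰ μI for all x), with ρ-Lipschitz continuous Hessian, i.e. ‖∇²h(x) − ∇²h(y)‖ ≤ ρ‖x − y‖ for all x, y (spectral norm). Then h is HRUC regular with distortion modulus ζ(δ) = exp(ρδ/μ²) − 1; i.e., for every δ ≥ 0 and all x, y ∈ ℝ^d with ‖∇h(x) − ∇h(y)‖ ≤ δ, one has ‖∇²h(x)[∇²h(y)]⁻¹ − I‖ ≤ exp(ρδ/μ²) − 1. -/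
open Matrix Real

lemma quad_aux {d : ℕ} (M : Matrix (Fin d) (Fin d) ℝ) (μ : ℝ)
    (hM : (M - μ • 1).PosSemidef) (v : EuclideanSpace ℝ (Fin d)) :
    μ * ‖v‖ ^ 2 ≤ inner ℝ (Matrix.toEuclideanCLM (𝕜 := ℝ) M v) v := by
  have h1 := hM.dotProduct_mulVec_nonneg v.ofLp
  rw [Matrix.sub_mulVec, dotProduct_sub, Matrix.smul_mulVec, Matrix.one_mulVec,
    dotProduct_smul] at h1
  have h2 : inner ℝ (Matrix.toEuclideanCLM (𝕜 := ℝ) M v) v = star v.ofLp ⬝ᵥ (M *ᵥ v.ofLp) := by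
    rw [EuclideanSpace.inner_eq_star_dotProduct]
    simp [Matrix.ofLp_toEuclideanCLM]
  have h3 : ‖v‖ ^ 2 = star v.ofLp ⬝ᵥ v.ofLp := by
    rw [← real_inner_self_eq_norm_sq, EuclideanSpace.inner_eq_star_dotProduct]
    simp
  rw [h2, h3]
  simpa using h1

lemma lower_aux {E : Type*} [NormedAddCommGroup E] [InnerProductSpace ℝ E] (μ : ℝ) (a v : E)
    (h : μ * ‖v‖ ^ 2 ≤ inner ℝ a v) : μ * ‖v‖ ≤ ‖a‖ := by
  rcases eq_or_lt_of_le (norm_nonneg v) with h0 | h0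
  · rw [← h0]; simp
  · have := real_inner_le_norm a v
    refine le_of_mul_le_mul_right ?_ h0
    nlinarith

lemma mono_aux {E : Type*} [NormedAddCommGroup E] [InnerProductSpace ℝ E] (μ : ℝ)
    (g : E → E) (g' : E → E →L[ℝ] E) (hg : ∀ x, HasFDerivAt g (g' x) x)
    (hq : ∀ x v, μ * ‖v‖ ^ 2 ≤ inner ℝ (g' x v) v) (x y : E) :
    μ * ‖x - y‖ ^ 2 ≤ inner ℝ (g x - g y) (x - y) := by
  set v := x - y with hv
  have hd : ∀ t : ℝ, HasDerivAt (fun t : ℝ => inner ℝ (g (y + t • v)) v)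
      (inner ℝ (g' (y + t • v) v) v) t := by
    intro t
    have h1 : HasDerivAt (fun t : ℝ => y + t • v) v t := by
      simpa using ((hasDerivAt_id t).smul_const v).const_add y
    have h2 := (hg (y + t • v)).comp_hasDerivAt t h1
    simpa using h2.inner ℝ (hasDerivAt_const t v)
  have := mul_sub_le_image_sub_of_le_deriv (f := fun t : ℝ => inner ℝ (g (y + t • v)) v)
    (fun t => (hd t).differentiableAt) (C := μ * ‖v‖ ^ 2)
    (fun t => by rw [(hd t).deriv]; exact hq _ _) (zero_le_one)
  simp only [one_smul, zero_smul, add_zero, sub_zero, mul_one, ← inner_sub_left] at this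
  simpa [hv] using this

/-- **HRUC regularity of strongly convex functions with Lipschitz Hessian.**
Let `μ, ρ > 0` and let `h : ℝ^d → ℝ` be three times continuously differentiable,
`μ`-strongly convex (`∇²h(x) ⪰ μI` for all `x`), with `ρ`-Lipschitz Hessian
(`‖∇²h(x) − ∇²h(y)‖ ≤ ρ‖x − y‖` in spectral norm). Then `h` is HRUC regular with
distortion modulus `ζ(δ) = exp(ρδ/μ²) − 1`: for every `δ ≥ 0` and all `x, y` with
`‖∇h(x) − ∇h(y)‖ ≤ δ`, one has `‖∇²h(x)[∇²h(y)]⁻¹ − I‖ ≤ exp(ρδ/μ²) − 1`. -/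
theorem hruc_strongly_convex_lipschitz_hessian {d : ℕ}
    (h : EuclideanSpace ℝ (Fin d) → ℝ)
    (grad : EuclideanSpace ℝ (Fin d) → EuclideanSpace ℝ (Fin d))
    (hess : EuclideanSpace ℝ (Fin d) → Matrix (Fin d) (Fin d) ℝ)
    (μ ρ : ℝ) (hμ : 0 < μ) (hρ : 0 < ρ)
    -- `h` is three times continuously differentiable
    (hsmooth : ContDiff ℝ 3 h)
    -- `grad` is the gradient of `h` and `hess` its Hessian
    (hgrad : ∀ x, HasGradientAt h (grad x) x)
    (hhess : ∀ x, HasFDerivAt grad (Matrix.toEuclideanCLM (𝕜 := ℝ) (hess x)) x)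
    (hsymm : ∀ x, (hess x).IsSymm)
    -- `h` is `μ`-strongly convex: `∇²h(x) ⪰ μ·I`
    (hstrong : ∀ x, (hess x - μ • 1).PosSemidef)
    -- the Hessian of `h` is `ρ`-Lipschitz continuous in spectral norm
    (hlip : ∀ x y : EuclideanSpace ℝ (Fin d),
      specNorm (hess x - hess y) ≤ ρ * ‖x - y‖) :
    ∀ δ : ℝ, 0 ≤ δ → ∀ x y : EuclideanSpace ℝ (Fin d),
      ‖grad x - grad y‖ ≤ δ →
        specNorm (hess x * (hess y)⁻¹ - 1) ≤ Real.exp (ρ * δ / μ ^ 2) - 1 := by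
  intro δ hδ x y hxy
  have hq : ∀ x v, μ * ‖v‖ ^ 2 ≤ inner ℝ (Matrix.toEuclideanCLM (𝕜 := ℝ) (hess x) v) v :=
    fun x v => quad_aux _ μ (hstrong x) v
  have hd : μ * ‖x - y‖ ≤ δ :=
    (lower_aux μ _ _ (mono_aux μ grad _ hhess hq x y)).trans hxy
  have hlow := fun v => lower_aux μ _ v (hq y v)
  have hpd : (hess y).PosDef := by
    have := (Matrix.PosDef.one (n := Fin d) (R := ℝ)).smul hμ
    simpa using Matrix.PosDef.posSemidef_add (hstrong y) this
  have hu : IsUnit (hess y).det := (Matrix.isUnit_iff_isUnit_det _).1 hpd.isUnit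
  have hmul : hess y * (hess y)⁻¹ = 1 := Matrix.mul_nonsing_inv _ hu
  have hinv : ‖Matrix.toEuclideanCLM (𝕜 := ℝ) (hess y)⁻¹‖ ≤ 1 / μ := by
    refine ContinuousLinearMap.opNorm_le_bound _ (by positivity) fun w => ?_
    have h1 := hlow (Matrix.toEuclideanCLM (𝕜 := ℝ) (hess y)⁻¹ w)
    rw [← ContinuousLinearMap.mul_apply, ← map_mul, hmul, map_one,
      ContinuousLinearMap.one_apply] at h1
    rw [div_mul_eq_mul_div, one_mul, le_div_iff₀ hμ]
    linarith
  have heq : hess x * (hess y)⁻¹ - 1 = (hess x - hess y) * (hess y)⁻¹ := by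
    rw [sub_mul, hmul]
  have h1 : specNorm (hess x * (hess y)⁻¹ - 1) ≤ (ρ * ‖x - y‖) * (1 / μ) := by
    rw [heq]
    unfold specNorm
    rw [map_mul]
    refine (norm_mul_le _ _).trans ?_
    exact mul_le_mul (hlip x y) hinv (norm_nonneg _) (by positivity)
  have h2 : (ρ * ‖x - y‖) * (1 / μ) ≤ ρ * δ / μ ^ 2 := by
    rw [mul_one_div, div_le_div_iff₀ hμ (by positivity)]
    nlinarith [mul_le_mul_of_nonneg_left hd (mul_pos hρ hμ).le]
  have h3 := Real.add_one_le_exp (ρ * δ / μ ^ 2)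
  linarith
end
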